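/- Let 0 < α < 1, a < b, let L : [a,b] × ℝⁿ × ℝⁿ → ℝ be of class C², let q : [a,b] → ℝⁿ be of class C², and let ξ : [a,b] × ℝⁿ → ℝⁿ be of class C¹. For ε ∈ ℝ set q̄_ε(t) = q(t) + ε ξ(t, q(t)). Suppose the functional I is invariant under this family without transformation of the independent variable: for every ε in a neighbourhood of 0 and every subinterval [t_a, t_b] ⊆ [a,b], ∫_{t_a}^{t_b} L(t, q(t), (ᴿᶜDᵅ q)(t)) dt = ∫_{t_a}^{t_b} L(t, q̄_ε(t), (ᴿᶜDᵅ q̄_ε)(t)) dt. Then for every t ∈ [a,b]: ∂₂L(t, q(t), (ᴿᶜDᵅ q)(t)) · ξ(t, q(t)) + ∂₃L(t, q(t), (ᴿᶜDᵅ q)(t)) · (ᴿᶜDᵅ [s ↦ ξ(s, q(s))])(t) = 0. -/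

import Mathlib

open Real Set MeasureTheory intervalIntegral
open scoped RealInnerProductSpace

/-- Riesz-type kernel integral of `g` on `[a,b]`:
`(1/(2Γ(1-α))) ∫_a^b |s-θ|^{-α} g(θ) dθ`. -/
noncomputable def rieszInt {E : Type*} [NormedAddCommGroup E] [NormedSpace ℝ E]
    (α a b : ℝ) (g : ℝ → E) (s : ℝ) : E :=
  (1 / (2 * Real.Gamma (1 - α))) • ∫ θ in a..b, |s - θ| ^ (-α) • g θ

/-- Riesz–Caputo fractional derivative of order `α` (for `0 < α < 1`) of `f` on `[a,b]`:
`(1/(2Γ(1-α))) ∫_a^b |t-θ|^{-α} f'(θ) dθ`. -/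
noncomputable def RCDeriv {E : Type*} [NormedAddCommGroup E] [NormedSpace ℝ E]
    (α a b : ℝ) (f : ℝ → E) (t : ℝ) : E :=
  rieszInt α a b (fun θ => derivWithin f (Set.Icc a b) θ) t

/-- Riesz fractional derivative of order `α` (for `0 < α < 1`) of `g` on `[a,b]`:
`d/dt [(1/(2Γ(1-α))) ∫_a^b |t-θ|^{-α} g(θ) dθ]`. -/
noncomputable def RDeriv {E : Type*} [NormedAddCommGroup E] [NormedSpace ℝ E]
    (α a b : ℝ) (g : ℝ → E) (t : ℝ) : E :=
  deriv (rieszInt α a b g) t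

theorem intervalIntegrable_abs_rpow {r : ℝ} (hr : -1 < r) (a b : ℝ) :
    IntervalIntegrable (fun x : ℝ => |x| ^ r) volume a b := by
  have hnonneg : ∀ c : ℝ, 0 ≤ c → IntervalIntegrable (fun x : ℝ => |x| ^ r) volume 0 c := by
    intro c hc
    refine (intervalIntegrable_rpow' hr).congr_uIoo fun x hx => ?_
    rw [uIoo_of_le hc] at hx
    simp only [abs_of_pos hx.1]
  have hzero : ∀ c : ℝ, IntervalIntegrable (fun x : ℝ => |x| ^ r) volume 0 c := by
    intro c
    rcases le_total 0 c with hc | hc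
    · exact hnonneg c hc
    · simpa using (hnonneg (-c) (by linarith)).comp_sub_left 0
  exact (hzero a).symm.trans (hzero b)

theorem intervalIntegrable_abs_sub_rpow_smul {E : Type*} [NormedAddCommGroup E] [NormedSpace ℝ E]
    {α a b : ℝ} (hα : α < 1) (hab : a ≤ b) {g : ℝ → E} (hg : ContinuousOn g (Icc a b)) (s : ℝ) :
    IntervalIntegrable (fun θ => |s - θ| ^ (-α) • g θ) volume a b := by
  have h := (intervalIntegrable_abs_rpow (r := -α) (by linarith) (s - a) (s - b)).comp_sub_left s
  simp only [sub_sub_cancel] at h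
  exact h.smul_continuousOn (by rwa [uIcc_of_le hab])

theorem rieszInt_congr {E : Type*} [NormedAddCommGroup E] [NormedSpace ℝ E]
    {α a b : ℝ} (hab : a ≤ b) {f g : ℝ → E} (hfg : EqOn f g (Icc a b)) :
    rieszInt α a b f = rieszInt α a b g := by
  funext s
  simp only [rieszInt]
  congr 1
  refine integral_congr fun θ hθ => ?_
  rw [uIcc_of_le hab] at hθ
  simp only [hfg hθ]

theorem rieszInt_add_smul {E : Type*} [NormedAddCommGroup E] [NormedSpace ℝ E]
    {α a b : ℝ} (hα : α < 1) (hab : a ≤ b) {f g : ℝ → E} (hf : ContinuousOn f (Icc a b))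
    (hg : ContinuousOn g (Icc a b)) (c s : ℝ) :
    rieszInt α a b (fun θ => f θ + c • g θ) s
      = rieszInt α a b f s + c • rieszInt α a b g s := by
  have h : ∀ θ, |s - θ| ^ (-α) • (f θ + c • g θ)
      = |s - θ| ^ (-α) • f θ + c • |s - θ| ^ (-α) • g θ := fun θ => by
    rw [smul_add, smul_comm c]
  simp only [rieszInt, h]
  have hgc : IntervalIntegrable (fun θ => c • |s - θ| ^ (-α) • g θ) volume a b :=
    (intervalIntegrable_abs_sub_rpow_smul hα hab hg s).smul c
  rw [intervalIntegral.integral_add (intervalIntegrable_abs_sub_rpow_smul hα hab hf s) hgc,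
    intervalIntegral.integral_smul, smul_add, smul_comm c]

theorem continuousOn_rieszInt {E : Type*} [NormedAddCommGroup E] [NormedSpace ℝ E]
    {α a b : ℝ} (hα : α < 1) (hab : a ≤ b) {g : ℝ → E} (hg : ContinuousOn g (Icc a b)) :
    ContinuousOn (rieszInt α a b g) (Icc a b) := by
  set G : ℝ → E := (Icc a b).indicator g with hG
  set K : ℝ → ℝ := (Icc (a - b) (b - a)).indicator fun u => |u| ^ (-α) with hK
  have hKint : Integrable K :=
    ((intervalIntegrable_iff_integrableOn_Icc_of_le (by linarith)).1
      (intervalIntegrable_abs_rpow (by linarith) _ _)).integrable_indicator measurableSet_Icc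
  have hGmeas : AEStronglyMeasurable G :=
    (aestronglyMeasurable_indicator_iff measurableSet_Icc).2
      (hg.aestronglyMeasurable measurableSet_Icc)
  obtain ⟨M, hM⟩ := isCompact_Icc.exists_bound_of_continuousOn hg
  have hGM : ∀ x, ‖G x‖ ≤ max M 0 := by
    intro x
    by_cases hx : x ∈ Icc a b
    · simpa [hG, hx] using Or.inl (hM x hx)
    · simp [hG, indicator_of_notMem hx]
  have hGcont : ∀ x, x ≠ a → x ≠ b → ContinuousAt G x := by
    intro x hxa hxb
    refine (hg.mono interior_subset).continuousAt_indicator ?_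
    rw [frontier_Icc hab]
    simp [hxa, hxb]
  have hcont : Continuous fun s => ∫ u, K u • G (s - u) := by
    refine continuous_iff_continuousAt.2 fun s₀ => ?_
    refine MeasureTheory.continuousAt_of_dominated (bound := fun u => ‖K u‖ * max M 0)
      (Filter.Eventually.of_forall fun s => ?_)
      (Filter.Eventually.of_forall fun s => Filter.Eventually.of_forall fun u => ?_)
      (hKint.norm.mul_const _) ?_
    · exact hKint.aestronglyMeasurable.smul
        (hGmeas.comp_quasiMeasurePreserving (quasiMeasurePreserving_sub_left volume s))
    · rw [norm_smul]
      exact mul_le_mul_of_nonneg_left (hGM _) (norm_nonneg _)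
    · filter_upwards [compl_mem_ae_iff.2 (measure_singleton (μ := volume) (s₀ - a)),
        compl_mem_ae_iff.2 (measure_singleton (μ := volume) (s₀ - b))] with u hua hub
      have hGu : ContinuousAt G (s₀ - u) :=
        hGcont _ (fun h => hua (by simp [← h])) (fun h => hub (by simp [← h]))
      exact continuousAt_const.smul
        (ContinuousAt.comp (f := fun s => s - u) hGu (by fun_prop))
  refine (hcont.const_smul (1 / (2 * Real.Gamma (1 - α)))).continuousOn.congr fun s hs => ?_
  simp only [rieszInt]
  congr 1
  change _ = ∫ u, K u • G (s - u)
  rw [integral_of_le hab, ← integral_Icc_eq_integral_Ioc,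
    ← MeasureTheory.integral_indicator measurableSet_Icc,
    ← integral_sub_left_eq_self (fun u => K u • G (s - u)) volume s]
  simp only [sub_sub_cancel]
  congr 1
  funext θ
  by_cases hθ : θ ∈ Icc a b
  · have hmem : s - θ ∈ Icc (a - b) (b - a) :=
      ⟨by linarith [hs.1, hθ.2], by linarith [hs.2, hθ.1]⟩
    simp [hG, hK, indicator_of_mem hθ, indicator_of_mem hmem]
  · simp [hG, indicator_of_notMem hθ]

/-- Two continuous functions on `[a,b]` with the same integral over every `[a,t]` coincide. -/
theorem eqOn_of_integral_eq {E : Type*} [NormedAddCommGroup E] [NormedSpace ℝ E] [CompleteSpace E]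
    {a b : ℝ} (hab : a < b) {f g : ℝ → E} (hf : ContinuousOn f (Icc a b))
    (hg : ContinuousOn g (Icc a b))
    (h : ∀ t ∈ Icc a b, ∫ x in a..t, f x = ∫ x in a..t, g x) : EqOn f g (Icc a b) := by
  intro t ht
  have hderiv : ∀ φ : ℝ → E, ContinuousOn φ (Icc a b) →
      HasDerivWithinAt (fun u => ∫ x in a..u, φ x) (φ t) (Icc a b) t := by
    intro φ hφ
    have : Fact (t ∈ Icc a b) := ⟨ht⟩
    refine integral_hasDerivWithinAt_right (t := Icc a b)
      ((hφ.mono (Icc_subset_Icc_right ht.2)).intervalIntegrable_of_Icc ht.1)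
      (hφ.stronglyMeasurableAtFilter_nhdsWithin measurableSet_Icc t) (hφ t ht)
  have hu := uniqueDiffOn_Icc hab t ht
  exact hu.eq_deriv _ (hderiv f hf) ((hderiv g hg).congr h (h t ht))

theorem continuousOn_RCDeriv {E : Type*} [NormedAddCommGroup E] [NormedSpace ℝ E]
    {α a b : ℝ} (hα : α < 1) (hab : a < b) {f : ℝ → E} (hf : ContDiffOn ℝ 1 f (Icc a b)) :
    ContinuousOn (RCDeriv α a b f) (Icc a b) :=
  continuousOn_rieszInt hα hab.le (hf.continuousOn_derivWithin (uniqueDiffOn_Icc hab) le_rfl)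

theorem RCDeriv_add_smul {E : Type*} [NormedAddCommGroup E] [NormedSpace ℝ E]
    {α a b : ℝ} (hα : α < 1) (hab : a < b) {f g : ℝ → E} (hf : ContDiffOn ℝ 1 f (Icc a b))
    (hg : ContDiffOn ℝ 1 g (Icc a b)) (c t : ℝ) :
    RCDeriv α a b (fun s => f s + c • g s) t
      = RCDeriv α a b f t + c • RCDeriv α a b g t := by
  have hu := uniqueDiffOn_Icc hab
  unfold RCDeriv
  rw [← rieszInt_add_smul hα hab.le (hf.continuousOn_derivWithin hu le_rfl)
    (hg.continuousOn_derivWithin hu le_rfl)]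
  refine congrFun (rieszInt_congr hab.le fun θ hθ => ?_) t
  exact ((hf.differentiableOn one_ne_zero θ hθ).hasDerivWithinAt.add
    ((hg.differentiableOn one_ne_zero θ hθ).hasDerivWithinAt.const_smul c)).derivWithin (hu θ hθ)

/-- The derivative at `0` of `Φ` along a line in the product, in terms of partial gradients. -/
theorem hasDerivAt_comp_add_smul_prod {E F : Type*} [NormedAddCommGroup E] [InnerProductSpace ℝ E]
    [CompleteSpace E] [NormedAddCommGroup F] [InnerProductSpace ℝ F] [CompleteSpace F]
    {Φ : E → F → ℝ} {y : E} {v : F}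
    (hΦ : DifferentiableAt ℝ (fun x : E × F => Φ x.1 x.2) (y, v)) (η : E) (w : F) :
    HasDerivAt (fun ε : ℝ => Φ (y + ε • η) (v + ε • w))
      (⟪gradient (fun y' => Φ y' v) y, η⟫ + ⟪gradient (fun v' => Φ y v') v, w⟫) 0 := by
  set A := fderiv ℝ (fun x : E × F => Φ x.1 x.2) (y, v) with hA
  have hfst : HasFDerivAt (fun y' => Φ y' v) (A.comp (.inl ℝ E F)) y :=
    hΦ.hasFDerivAt.comp (f := fun y' => (y', v)) y (hasFDerivAt_prodMk_left y v)
  have hsnd : HasFDerivAt (fun v' => Φ y v') (A.comp (.inr ℝ E F)) v :=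
    hΦ.hasFDerivAt.comp (f := fun v' => (y, v')) v (hasFDerivAt_prodMk_right y v)
  rw [inner_gradient_left, inner_gradient_left, hfst.fderiv, hsnd.fderiv]
  have hline : HasDerivAt (fun ε : ℝ => (y + ε • η, v + ε • w)) (η, w) 0 := by
    have h₁ := ((hasDerivAt_id (0 : ℝ)).smul_const η).const_add y
    have h₂ := ((hasDerivAt_id (0 : ℝ)).smul_const w).const_add v
    simpa using h₁.prodMk h₂
  have hcomp := HasFDerivAt.comp_hasDerivAt (l := fun x : E × F => Φ x.1 x.2) (l' := A)
    (0 : ℝ) (by simpa using hΦ.hasFDerivAt) hline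
  refine hcomp.congr_deriv ?_
  simp [← map_add]

/-- (Necessary condition of invariance without transformation of time.)
If the functional `I[q] = ∫_a^b L(t,q(t),(ᴿᶜDᵅq)(t)) dt` is invariant under the family of
transformations `q̄_ε(t) = q(t) + ε ξ(t,q(t))` (without transformation of the independent
variable), then
`∂₂L(t,q(t),(ᴿᶜDᵅq)(t)) ⬝ ξ(t,q(t)) + ∂₃L(t,q(t),(ᴿᶜDᵅq)(t)) ⬝ (ᴿᶜDᵅ[s ↦ ξ(s,q(s))])(t) = 0`
for every `t ∈ [a,b]`. -/
theorem necessary_condition_of_invariance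
    {n : ℕ} (α a b : ℝ) (hα0 : 0 < α) (hα1 : α < 1) (hab : a < b)
    (L : ℝ → EuclideanSpace ℝ (Fin n) → EuclideanSpace ℝ (Fin n) → ℝ)
    (hL : ContDiff ℝ 2 (fun x : ℝ × EuclideanSpace ℝ (Fin n) × EuclideanSpace ℝ (Fin n) =>
      L x.1 x.2.1 x.2.2))
    (q : ℝ → EuclideanSpace ℝ (Fin n)) (hq : ContDiffOn ℝ 2 q (Set.Icc a b))
    (ξ : ℝ → EuclideanSpace ℝ (Fin n) → EuclideanSpace ℝ (Fin n))
    (hξ : ContDiff ℝ 1 (fun x : ℝ × EuclideanSpace ℝ (Fin n) => ξ x.1 x.2))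
    -- invariance without transformation of the independent variable:
    (hinv : ∃ δ > (0:ℝ), ∀ ε : ℝ, |ε| < δ →
      ∀ ta tb : ℝ, a ≤ ta → ta ≤ tb → tb ≤ b →
        ∫ t in ta..tb, L t (q t) (RCDeriv α a b q t)
          = ∫ t in ta..tb, L t (q t + ε • ξ t (q t))
              (RCDeriv α a b (fun s => q s + ε • ξ s (q s)) t)) :
    ∀ t ∈ Set.Icc a b,
      ⟪gradient (fun y => L t y (RCDeriv α a b q t)) (q t), ξ t (q t)⟫
        + ⟪gradient (fun v => L t (q t) v) (RCDeriv α a b q t),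
            RCDeriv α a b (fun s => ξ s (q s)) t⟫ = 0 := by
  intro t ht
  obtain ⟨δ, hδ, hinv⟩ := hinv
  have hq1 : ContDiffOn ℝ 1 q (Icc a b) := hq.of_le one_le_two
  have hη : ContDiffOn ℝ 1 (fun s => ξ s (q s)) (Icc a b) :=
    hξ.comp_contDiffOn (contDiffOn_id.prodMk hq1)
  have hLcont : ∀ y v : ℝ → EuclideanSpace ℝ (Fin n), ContinuousOn y (Icc a b) →
      ContinuousOn v (Icc a b) → ContinuousOn (fun t => L t (y t) (v t)) (Icc a b) :=
    fun y v hy hv => hL.continuous.comp_continuousOn (continuousOn_id.prodMk (hy.prodMk hv))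
  have hDq := continuousOn_RCDeriv hα1 hab hq1
  have hDη := continuousOn_RCDeriv hα1 hab hη
  have hconst : ∀ ε : ℝ, |ε| < δ →
      L t (q t + ε • ξ t (q t))
        (RCDeriv α a b q t + ε • RCDeriv α a b (fun s => ξ s (q s)) t)
        = L t (q t) (RCDeriv α a b q t) := by
    intro ε hε
    have hint := hinv ε hε
    simp only [RCDeriv_add_smul hα1 hab hq1 hη] at hint
    exact (eqOn_of_integral_eq hab (hLcont _ _ hq1.continuousOn hDq)
      (hLcont _ _ (hq1.continuousOn.add (hη.continuousOn.const_smul ε))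
        (hDq.add (hDη.const_smul ε)))
      (fun u hu => hint a u le_rfl hu.1 hu.2) ht).symm
  have hΦ : Differentiable ℝ
      (fun x : EuclideanSpace ℝ (Fin n) × EuclideanSpace ℝ (Fin n) => L t x.1 x.2) :=
    (hL.differentiable two_ne_zero).comp ((differentiable_const t).prodMk differentiable_id)
  have hderiv := hasDerivAt_comp_add_smul_prod (hΦ (q t, RCDeriv α a b q t)) (ξ t (q t))
    (RCDeriv α a b (fun s => ξ s (q s)) t)
  refine hderiv.unique
    ((hasDerivAt_const (0 : ℝ) (L t (q t) (RCDeriv α a b q t))).congr_of_eventuallyEq ?_)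
  filter_upwards [Metric.ball_mem_nhds (0 : ℝ) hδ] with ε hε
  exact hconst ε (by simpa using hε)
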